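/- arXiv:1711.09016 — 3 statements merged into one kernel-verified Lean document; each statement's English description precedes it below -/
import Mathlib

section
/- For every integer n ≥ 1, the polynomials Ã_n(x) satisfy Ã_{n+1}(x) = (1+(n+1)x)·Ã_n(x) + x(1−x)·Ã_n′(x) − n·x·Ã_{n−1}(x), where Ã_n′ denotes the formal derivative of Ã_n. -/
open Finset Polynomial

/-- The number of descents of a permutation of `{1, …, m+1}`. -/
def des {m : ℕ} (π : Equiv.Perm (Fin (m + 1))) : ℕ :=
  (Finset.univ.filter fun i : Fin m => π i.succ < π i.castSucc).card

/-- The set `𝒬_{m+1}` of permutations of `{1, …, m+1}` whose largest entry appears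
as the first descent (the identity permutation is included). -/
def Qset (m : ℕ) : Finset (Equiv.Perm (Fin (m + 1))) :=
  Finset.univ.filter fun π =>
    ∀ i : Fin m, i.succ ≤ π⁻¹ (Fin.last m) → π i.castSucc < π i.succ

/-- The binomial-Eulerian polynomial `Ã_n(x) = Σ_{π ∈ 𝒬_{n+1}} x^{des π}`. -/
noncomputable def Atilpoly (n : ℕ) : Polynomial ℤ :=
  ∑ π ∈ Qset n, X ^ des π

/-- Insert a new minimum at position `j`. -/
def insMin {n : ℕ} (j : Fin (n + 2)) (σ : Equiv.Perm (Fin (n + 1))) :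
    Equiv.Perm (Fin (n + 2)) :=
  ((finSuccEquiv' j).trans (Equiv.optionCongr σ)).trans (finSuccEquiv' 0).symm

lemma insMin_self {n : ℕ} (j : Fin (n + 2)) (σ : Equiv.Perm (Fin (n + 1))) :
    insMin j σ j = 0 := by
  simp [insMin]

lemma insMin_succAbove {n : ℕ} (j : Fin (n + 2)) (σ : Equiv.Perm (Fin (n + 1)))
    (i : Fin (n + 1)) : insMin j σ (j.succAbove i) = (σ i).succ := by
  simp [insMin]

lemma insMin_bij (n : ℕ) : Function.Bijective
    (fun a : Fin (n + 2) × Equiv.Perm (Fin (n + 1)) => insMin a.1 a.2) := by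
  rw [Fintype.bijective_iff_injective_and_card]
  constructor
  · rintro ⟨j, σ⟩ ⟨k, τ⟩ h
    simp only at h
    have hjk : j = k := by
      apply (insMin j σ).injective
      rw [insMin_self, h, insMin_self]
    subst hjk
    have : σ = τ := by
      ext1 i
      have h1 := insMin_succAbove j σ i
      rw [h, insMin_succAbove] at h1
      exact (Fin.succ_injective _ h1).symm
    rw [this]
  · simp [Fintype.card_perm, Nat.factorial_succ]

/-- Position of the maximum. -/
def pos {n : ℕ} (σ : Equiv.Perm (Fin (n + 1))) : Fin (n + 1) := σ⁻¹ (Fin.last n)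

lemma pos_insMin {n : ℕ} (j : Fin (n + 2)) (σ : Equiv.Perm (Fin (n + 1))) :
    pos (insMin j σ) = j.succAbove (pos σ) := by
  unfold pos
  rw [Equiv.Perm.inv_eq_iff_eq, insMin_succAbove]
  simp

lemma mem_Qset {n : ℕ} (σ : Equiv.Perm (Fin (n + 1))) :
    σ ∈ Qset n ↔ ∀ i : Fin n, (i : ℕ) < pos σ → σ i.castSucc < σ i.succ := by
  simp only [Qset, mem_filter, mem_univ, true_and]
  rfl

lemma des_eq {n : ℕ} (σ : Equiv.Perm (Fin (n + 1))) :
    des σ = ∑ i : Fin n, if σ i.succ < σ i.castSucc then 1 else 0 := by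
  simp [des]

lemma insMin_zero_succ {n : ℕ} (σ : Equiv.Perm (Fin (n + 1))) (i : Fin (n + 1)) :
    insMin 0 σ i.succ = (σ i).succ := by
  simpa using insMin_succAbove 0 σ i

lemma insMin_lt {n : ℕ} (j : Fin (n + 2)) (σ : Equiv.Perm (Fin (n + 1))) (i : Fin (n + 1))
    (q : Fin (n + 2)) (hq : (q : ℕ) = i) (h : (i : ℕ) < j) :
    insMin j σ q = (σ i).succ := by
  have : q = j.succAbove i := by
    rw [Fin.succAbove_of_castSucc_lt _ _ (by simpa [Fin.lt_def] using h)]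
    ext; simpa using hq
  rw [this, insMin_succAbove]

lemma insMin_ge {n : ℕ} (j : Fin (n + 2)) (σ : Equiv.Perm (Fin (n + 1))) (i : Fin (n + 1))
    (q : Fin (n + 2)) (hq : (q : ℕ) = i + 1) (h : (j : ℕ) ≤ i) :
    insMin j σ q = (σ i).succ := by
  have : q = j.succAbove i := by
    rw [Fin.succAbove_of_le_castSucc _ _ (by simpa [Fin.le_def] using h)]
    ext; simpa using hq
  rw [this, insMin_succAbove]

lemma des_insMin_zero {n : ℕ} (σ : Equiv.Perm (Fin (n + 1))) :
    des (insMin 0 σ) = des σ := by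
  rw [des_eq, des_eq, Fin.sum_univ_succ]
  have : insMin 0 σ (Fin.castSucc 0) = 0 := insMin_self 0 σ
  rw [this]
  simp only [Fin.not_lt_zero, if_false, zero_add]
  apply sum_congr rfl
  intro i _
  rw [insMin_zero_succ, ← Fin.succ_castSucc, insMin_zero_succ]
  simp

lemma des_insMin_succ {n : ℕ} (k : Fin (n + 1)) (σ : Equiv.Perm (Fin (n + 1))) :
    des (insMin k.succ σ) = 1 + ∑ i : Fin n,
      if i.castSucc = k then 0 else if σ i.succ < σ i.castSucc then 1 else 0 := by
  rw [des_eq, Fin.sum_univ_succAbove _ k, insMin_self,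
    insMin_lt k.succ σ k k.castSucc (by simp) (by simp)]
  simp only [Fin.succ_pos, if_true]
  congr 1
  apply sum_congr rfl
  intro i _
  rcases lt_trichotomy (i : ℕ) k with h | h | h
  · rw [Fin.succAbove_of_castSucc_lt _ _ (by simpa [Fin.lt_def] using h),
      insMin_lt _ _ i.succ _ (by simp) (by simpa using h),
      insMin_lt _ _ i.castSucc _ (by simp) (by simp; omega),
      if_neg (c := i.castSucc = k) (fun e => by have := congrArg Fin.val e; simp at this; omega)]
    simp
  · have hk : i.castSucc = k := by ext; simpa using h
    rw [if_pos hk, ← hk, Fin.succAbove_castSucc_self]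
    have : (i.succ.castSucc : Fin (n + 2)) = i.castSucc.succ := by ext; simp
    rw [this, insMin_self]
    simp
  · rw [Fin.succAbove_of_le_castSucc _ _ (by simp [Fin.le_def]; omega),
      insMin_ge _ _ i.succ _ (by simp) (by simp; omega),
      insMin_ge _ _ i.castSucc _ (by simp) (by simp; omega),
      if_neg (c := i.castSucc = k) (fun e => by have := congrArg Fin.val e; simp at this; omega)]
    simp

lemma des_insMin_last {n : ℕ} (σ : Equiv.Perm (Fin (n + 1))) :
    des (insMin (Fin.last n).succ σ) = des σ + 1 := by
  rw [des_insMin_succ, des_eq, add_comm]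
  congr 1
  apply sum_congr rfl
  intro i _
  rw [if_neg (Fin.castSucc_ne_last i)]

lemma des_insMin_mid {n : ℕ} (i : Fin n) (σ : Equiv.Perm (Fin (n + 1))) :
    des (insMin i.castSucc.succ σ) =
      if σ i.succ < σ i.castSucc then des σ else des σ + 1 := by
  rw [des_insMin_succ, des_eq]
  simp only [Fin.castSucc_inj]
  rw [← Finset.add_sum_erase univ _ (mem_univ i),
    ← Finset.add_sum_erase (s := univ) (a := i)
      (f := fun i : Fin n => if σ i.succ < σ i.castSucc then 1 else 0) (mem_univ i)]
  have : ∀ x ∈ univ.erase i, (if x = i then 0 else if σ x.succ < σ x.castSucc then 1 else 0)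
      = (if σ x.succ < σ x.castSucc then 1 else 0) := by
    intro x hx
    rw [if_neg (ne_of_mem_erase hx)]
  rw [sum_congr rfl this, if_pos rfl]
  generalize (∑ x ∈ univ.erase i, if σ x.succ < σ x.castSucc then 1 else 0) = S
  split_ifs <;> omega

lemma pos_zero {n : ℕ} (σ : Equiv.Perm (Fin (n + 1))) :
    (pos (insMin 0 σ) : ℕ) = pos σ + 1 := by
  rw [pos_insMin]; simp

lemma pos_succ {n : ℕ} (k : Fin (n + 1)) (σ : Equiv.Perm (Fin (n + 1))) (h : pos σ ≤ k) :
    (pos (insMin k.succ σ) : ℕ) = pos σ := by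
  rw [pos_insMin, Fin.succAbove_of_castSucc_lt _ _
    (by simp only [Fin.lt_def, Fin.le_def, Fin.val_castSucc, Fin.val_succ] at *; omega)]
  simp

lemma mem_zero {n : ℕ} (σ : Equiv.Perm (Fin (n + 1))) :
    insMin 0 σ ∈ Qset (n + 1) ↔ σ ∈ Qset n := by
  rw [mem_Qset, mem_Qset, pos_zero]
  constructor
  · intro h i hi
    have := h i.succ (by simpa using hi)
    rwa [insMin_zero_succ, ← Fin.succ_castSucc, insMin_zero_succ, Fin.succ_lt_succ_iff] at this
  · intro h i
    refine Fin.cases ?_ (fun i => ?_) i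
    · intro _
      have : insMin 0 σ (Fin.castSucc 0) = 0 := insMin_self 0 σ
      rw [this, insMin_zero_succ]
      exact Fin.succ_pos _
    · intro hi
      rw [insMin_zero_succ, ← Fin.succ_castSucc, insMin_zero_succ, Fin.succ_lt_succ_iff]
      exact h i (by simpa using hi)

lemma mem_succ {n : ℕ} (k : Fin (n + 1)) (σ : Equiv.Perm (Fin (n + 1))) :
    insMin k.succ σ ∈ Qset (n + 1) ↔ σ ∈ Qset n ∧ pos σ ≤ k := by
  by_cases hk : pos σ ≤ k
  · simp only [hk, and_true]
    rw [mem_Qset, mem_Qset, pos_succ k σ hk]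
    rw [Fin.le_def] at hk
    have key : ∀ i : Fin n, (i : ℕ) < pos σ →
        (insMin k.succ σ i.castSucc.castSucc < insMin k.succ σ i.castSucc.succ ↔
          σ i.castSucc < σ i.succ) := by
      intro i hi
      rw [insMin_lt _ _ i.succ i.castSucc.succ (by simp) (by simp; omega),
        insMin_lt _ _ i.castSucc _ (by simp) (by simp; omega)]
      simp
    constructor
    · intro h i hi
      exact (key i hi).1 (h i.castSucc (by simpa using hi))
    · intro h i hi
      have hin : (i : ℕ) < n := by have := (pos σ).2; omega
      have := (key ⟨i, hin⟩ hi).2 (h ⟨i, hin⟩ hi)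
      exact this
  · simp only [hk, and_false, iff_false]
    rw [mem_Qset]
    intro h
    have h1 := h k (by
      rw [pos_insMin, Fin.succAbove_of_le_castSucc _ _
        (by simp only [Fin.lt_def, Fin.le_def, Fin.val_castSucc, Fin.val_succ] at *; omega)]
      simp only [Fin.lt_def, Fin.le_def, Fin.val_castSucc, Fin.val_succ] at *; omega)
    rw [insMin_self] at h1
    exact absurd h1 (Fin.not_lt_zero _)

lemma sum_ins {n : ℕ} (w : ℕ → ℤ[X]) :
    ∑ π ∈ Qset (n + 1), w (pos π) * X ^ des π =
      ∑ σ ∈ Qset n, (w (pos σ + 1) * X ^ des σ + w (pos σ) * (X ^ (des σ + 1) +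
        (des σ : ℤ[X]) * X ^ des σ +
        ((n : ℤ[X]) - ((pos σ : ℕ) : ℤ[X]) - (des σ : ℤ[X])) * X ^ (des σ + 1))) := by
  have h0 : ∀ m, ∀ g : Equiv.Perm (Fin (m + 1)) → ℤ[X], ∑ π ∈ Qset m, g π
      = ∑ π, if π ∈ Qset m then g π else 0 := by
    intro m g
    rw [← Finset.sum_filter]; congr 1; ext; simp
  rw [h0, h0, ← (insMin_bij n).sum_comp, Fintype.sum_prod_type_right]
  apply sum_congr rfl
  intro σ _
  rw [Fin.sum_univ_succ]
  simp only [mem_zero, mem_succ]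
  by_cases hσ : σ ∈ Qset n
  swap
  · simp [hσ]
  simp only [hσ, if_true, true_and, pos_zero, des_insMin_zero]
  congr 1
  have h1 : ∀ k : Fin (n + 1), (if pos σ ≤ k then
      w (pos (insMin k.succ σ)) * X ^ des (insMin k.succ σ) else 0) =
      w (pos σ) * (if pos σ ≤ k then X ^ des (insMin k.succ σ) else 0) := by
    intro k
    split_ifs with h
    · rw [pos_succ k σ h]
    · simp
  rw [sum_congr rfl (fun k _ => h1 k), ← mul_sum]
  congr 1
  rw [Fin.sum_univ_castSucc, if_pos (Fin.le_last _), des_insMin_last]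
  have h2 : ∀ i : Fin n, (if pos σ ≤ i.castSucc then
      (X : ℤ[X]) ^ des (insMin i.castSucc.succ σ) else 0) =
      (if σ i.succ < σ i.castSucc then 1 else 0) * (X ^ des σ - X ^ (des σ + 1)) +
      (if (pos σ : ℕ) ≤ (i : ℕ) then 1 else 0) * X ^ (des σ + 1) := by
    intro i
    rw [des_insMin_mid]
    by_cases h : (pos σ : ℕ) ≤ i
    · have h' : pos σ ≤ i.castSucc := h
      rw [if_pos h', if_pos h]
      split_ifs <;> ring
    · have h' : ¬ pos σ ≤ i.castSucc := h
      rw [if_neg h', if_neg h, if_neg (not_lt.2 ((mem_Qset σ).1 hσ i (not_le.1 h)).le)]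
      ring
  rw [sum_congr rfl (fun k _ => h2 k), sum_add_distrib, ← sum_mul, ← sum_mul]
  have h3 : (∑ i : Fin n, if σ i.succ < σ i.castSucc then (1 : ℤ[X]) else 0) = des σ := by
    rw [des_eq]; push_cast; rfl
  have h4 : (∑ i : Fin n, if (pos σ : ℕ) ≤ (i : ℕ) then (1 : ℤ[X]) else 0)
      = (n : ℤ[X]) - ((pos σ : ℕ) : ℤ[X]) := by
    rw [Fin.sum_univ_eq_sum_range (fun i => if (pos σ : ℕ) ≤ i then (1 : ℤ[X]) else 0) n]
    have hle : (pos σ : ℕ) ≤ n := Nat.lt_succ_iff.1 (pos σ).2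
    generalize (pos σ : ℕ) = p at hle
    rw [← Nat.cast_sub hle, sum_boole]
    congr 1
    have : (range n).filter (fun i => p ≤ i) = Ico p n := by
      ext; simp; omega
    rw [this, Nat.card_Ico]
  rw [h3, h4]
  ring

/-- Refinement by the position of the maximum. -/
noncomputable def fpoly (n q : ℕ) : ℤ[X] :=
  ∑ σ ∈ Qset n, (if (pos σ : ℕ) = q then 1 else 0) * X ^ des σ

/-- Right-hand side operator. -/
noncomputable def Rop (n q : ℕ) : ℤ[X] :=
  X * (1 - X) * derivative (fpoly n q) + ((n : ℤ[X]) + 1 - (q : ℤ[X])) * X * fpoly n q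

lemma Rop_eq (n q : ℕ) : Rop n q = ∑ σ ∈ Qset n, (if (pos σ : ℕ) = q then 1 else 0) *
      (X ^ (des σ + 1) + (des σ : ℤ[X]) * X ^ des σ +
        ((n : ℤ[X]) - ((pos σ : ℕ) : ℤ[X]) - (des σ : ℤ[X])) * X ^ (des σ + 1)) := by
  unfold Rop fpoly
  rw [derivative_sum, mul_sum, mul_sum, ← sum_add_distrib]
  apply sum_congr rfl
  intro σ _
  split_ifs with h
  · subst h
    rw [one_mul, derivative_X_pow]
    rcases Nat.eq_zero_or_pos (des σ) with h | h
    · rw [h]; simp; ring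
    · obtain ⟨d, hd⟩ : ∃ d, des σ = d + 1 := ⟨des σ - 1, by omega⟩
      rw [hd]
      simp
      ring
  · simp

lemma fpoly_zero (n : ℕ) : fpoly (n + 1) 0 = Rop n 0 := by
  rw [Rop_eq, fpoly, sum_ins (fun p => if p = 0 then 1 else 0)]
  simp

lemma fpoly_succ (n q : ℕ) : fpoly (n + 1) (q + 1) = fpoly n q + Rop n (q + 1) := by
  rw [Rop_eq, fpoly, sum_ins (fun p => if p = q + 1 then 1 else 0), sum_add_distrib, fpoly]
  simp

lemma fpoly_base (q : ℕ) : fpoly 0 (q + 1) = 0 := by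
  unfold fpoly
  apply sum_eq_zero
  intro σ _
  rw [if_neg (by have := (pos σ).2; omega), zero_mul]

lemma fpoly_shift (n : ℕ) : ∀ q : ℕ,
    ((q : ℤ[X]) + 1) * fpoly (n + 1) (q + 1) = ((n : ℤ[X]) + 1) * fpoly n q := by
  induction n with
  | zero =>
    intro q
    rw [fpoly_succ, Rop, fpoly_base]
    cases q with
    | zero => simp
    | succ q => simp [fpoly_base]
  | succ n ih =>
    intro q
    have hd := congrArg derivative (ih q)
    have e1 : ∀ (m : ℕ) (g : ℤ[X]), derivative (((m : ℤ[X]) + 1) * g)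
        = ((m : ℤ[X]) + 1) * derivative g := by
      intro m g; simp
    rw [e1, e1] at hd
    have hq := ih q
    have hR : Rop n q = X * (1 - X) * derivative (fpoly n q)
      + ((n : ℤ[X]) + 1 - (q : ℤ[X])) * X * fpoly n q := rfl
    have h3 : ((n : ℤ[X]) + 1) * Rop n q = ((n : ℤ[X]) + 1 - q) * fpoly (n + 1) q := by
      cases q with
      | zero => rw [fpoly_zero]; simp
      | succ q =>
        have := ih q
        have h4 := fpoly_succ n q
        push_cast
        linear_combination (-((n : ℤ[X]) + 1)) * h4 + this
    rw [fpoly_succ, Rop]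
    rw [hR] at h3
    push_cast
    linear_combination X * (1 - X) * hd + ((n : ℤ[X]) + 1 - q) * X * hq + h3

lemma sum_fpoly (n : ℕ) : Atilpoly n = ∑ q ∈ range (n + 1), fpoly n q := by
  unfold fpoly Atilpoly
  rw [sum_comm]
  apply sum_congr rfl
  intro σ _
  rw [← sum_mul, sum_ite_eq, if_pos (mem_range.2 (pos σ).2), one_mul]

lemma sum_pos (n : ℕ) : ∑ σ ∈ Qset (n + 1), ((pos σ : ℕ) : ℤ[X]) * X ^ des σ
    = ((n : ℤ[X]) + 1) * Atilpoly n := by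
  have : ∑ σ ∈ Qset (n + 1), ((pos σ : ℕ) : ℤ[X]) * X ^ des σ
      = ∑ q ∈ range (n + 2), (q : ℤ[X]) * fpoly (n + 1) q := by
    unfold fpoly
    simp only [mul_sum]
    rw [sum_comm]
    apply sum_congr rfl
    intro σ _
    simp only [← mul_assoc]
    rw [← sum_mul]
    congr 1
    simp only [mul_ite, mul_one, mul_zero]
    rw [sum_ite_eq, if_pos (mem_range.2 (pos σ).2)]
  rw [this, sum_range_succ', sum_fpoly, mul_sum]
  simp [fpoly_shift]

theorem Atilpoly_recurrence (n : ℕ) (hn : 1 ≤ n) :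
    Atilpoly (n + 1) =
      (1 + ((n : Polynomial ℤ) + 1) * X) * Atilpoly n
        + X * (1 - X) * derivative (Atilpoly n)
        - (n : Polynomial ℤ) * X * Atilpoly (n - 1) := by
  obtain ⟨m, rfl⟩ : ∃ m, n = m + 1 := ⟨n - 1, by omega⟩
  have h1 := sum_ins (n := m + 1) (fun _ => 1)
  have h2 := sum_pos m
  simp only [one_mul] at h1
  have h3 : ((m + 1 : ℕ) : ℤ[X]) * X * Atilpoly (m + 1 - 1)
      = X * ∑ σ ∈ Qset (m + 1), ((pos σ : ℕ) : ℤ[X]) * X ^ des σ := by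
    rw [h2, Nat.add_sub_cancel]; push_cast; ring
  rw [h3]
  unfold Atilpoly
  rw [h1, derivative_sum, mul_sum, mul_sum, mul_sum, ← sum_add_distrib, ← sum_sub_distrib]
  apply sum_congr rfl
  intro σ _
  rw [derivative_X_pow]
  rcases Nat.eq_zero_or_pos (des σ) with h | h
  · rw [h]; simp; ring
  · obtain ⟨d, hd⟩ : ∃ d, des σ = d + 1 := ⟨des σ - 1, by omega⟩
    rw [hd]
    simp
    ring
end

section
/- The binomial-Eulerian polynomials are symmetric: for all integers n ≥ 0 and 0 ≤ k ≤ n, Ã(n,k) = Ã(n,n−k); equivalently, Ã_n(x) = x^n·Ã_n(1/x). -/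
open Finset

/-- `Ã(n,k)`: the number of permutations in `𝒬_{n+1}` with exactly `k` descents. -/
def Atil (n k : ℕ) : ℕ := ((Qset n).filter fun π => des π = k).card

section helpers
variable {α : Type*} [LinearOrder α]

/-- descents of a list -/
def dl : List α → ℕ
  | [] => 0
  | [_] => 0
  | x :: y :: s => (if y < x then 1 else 0) + dl (y :: s)

/-- the list is increasing up to `M` -/
def QL (M : α) : List α → Prop
  | [] => True
  | [_] => True
  | x :: y :: s => (M ∈ y :: s → x < y) ∧ QL M (y :: s)

/-- The symmetric relation giving the involution. -/
inductive RR (M : α) : List α → List α → Prop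
  | base : RR M [M] [M]
  | c1 (a : α) (u u' : List α) : RR M u u' → (∀ x ∈ u, a < x) → RR M (a :: u) (u' ++ [a])
  | c2 (a : α) (u u' : List α) : RR M u u' → (∀ x ∈ u, a < x) → RR M (u ++ [a]) (a :: u')
  | c3 (a : α) (u u' v : List α) : RR M u u' → (∀ x ∈ u, a < x) → (∀ x ∈ v, a < x) →
      v ≠ [] → v.Nodup → M ∉ v → RR M (u ++ a :: v) (u' ++ a :: v.reverse)

theorem RR.perm {M : α} {u u' : List α} (h : RR M u u') : u.Perm u' := by
  induction h with
  | base => rfl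
  | c1 a u u' _ _ ih =>
    exact (ih.cons a).trans (List.perm_append_singleton a u').symm
  | c2 a u u' _ _ ih =>
    exact (List.perm_append_singleton a u).trans (ih.cons a)
  | c3 a u u' v _ _ _ _ _ _ ih =>
    exact ih.append ((List.reverse_perm v).symm.cons a)

theorem RR.mem {M : α} {u u' : List α} (h : RR M u u') : M ∈ u := by
  induction h <;> simp_all

theorem RR.mem' {M : α} {u u' : List α} (h : RR M u u') : M ∈ u' := h.perm.mem_iff.1 h.mem

theorem QL_append {M : α} (u w : List α) (hw : M ∉ w) : QL M (u ++ w) ↔ QL M u := by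
  have key : ∀ w : List α, M ∉ w → QL M w := by
    intro w
    induction w with
    | nil => intro _; trivial
    | cons x s ih =>
      intro h
      cases s with
      | nil => trivial
      | cons y s =>
        have : M ∉ y :: s := fun h' => h (List.mem_cons_of_mem _ h')
        exact ⟨fun h' => absurd h' this, ih this⟩
  induction u with
  | nil => simpa [QL] using key w hw
  | cons x s ih =>
    cases s with
    | nil =>
      cases w with
      | nil => simp
      | cons y w =>
        simp only [List.cons_append, List.nil_append, QL, iff_true]
        exact ⟨fun h' => absurd h' hw, key _ hw⟩
    | cons y s =>
      refine and_congr ?_ ih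
      simp [hw]

theorem QL_cons {M a : α} (u : List α) (h : ∀ x ∈ u, a < x) : QL M (a :: u) ↔ QL M u := by
  cases u with
  | nil => simp [QL]
  | cons y s => simp [QL, h y]

theorem QL_mem {M a : α} (u v : List α) (hu : u ≠ []) (hM : M ∈ a :: v)
    (h : QL M (u ++ a :: v)) : ∃ x ∈ u, x < a := by
  induction u with
  | nil => simp at hu
  | cons x s ih =>
    cases s with
    | nil => exact ⟨x, by simp, h.1 hM⟩
    | cons y s =>
      obtain ⟨z, hz, hz'⟩ := ih (by simp) h.2
      exact ⟨z, List.mem_cons_of_mem _ hz, hz'⟩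

theorem RR.QL' {M : α} {u u' : List α} (h : RR M u u') : QL M u' := by
  induction h with
  | base => trivial
  | c1 a u u' h hl ih =>
    rw [QL_append]; exact ih
    have := hl M h.mem
    simpa using this.ne'
  | c2 a u u' h hl ih =>
    rw [QL_cons]; exact ih
    intro x hx; exact hl x (h.perm.mem_iff.2 hx)
  | c3 a u u' v h hl hv _ _ hM ih =>
    rw [QL_append]; exact ih
    have := hl M h.mem
    simp [this.ne', hM]

theorem dl_append {a : α} (u v : List α) (hu : u ≠ []) (h : ∀ x ∈ u, a < x) :
    dl (u ++ a :: v) = dl u + 1 + dl (a :: v) := by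
  induction u with
  | nil => simp at hu
  | cons x s ih =>
    cases s with
    | nil => simp [dl, h x]
    | cons y s =>
      have := ih (by simp) (fun z hz => h z (List.mem_cons_of_mem _ hz))
      simp only [List.cons_append, dl] at this ⊢
      omega

theorem dl_cons {a : α} (u : List α) (h : ∀ x ∈ u, a < x) : dl (a :: u) = dl u := by
  cases u with
  | nil => simp [dl]
  | cons y s => simp [dl, (h y (by simp)).le]

theorem dl_snoc {a b : α} (l : List α) :
    dl (l ++ [b, a]) = dl (l ++ [b]) + (if a < b then 1 else 0) := by
  induction l with
  | nil => simp [dl]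
  | cons x s ih =>
    cases s with
    | nil => simp [dl]
    | cons y s =>
      simp only [List.cons_append, dl] at ih ⊢
      omega

theorem dl_reverse (v : List α) (hv : v ≠ []) (h : v.Nodup) :
    dl v + dl v.reverse + 1 = v.length := by
  induction v with
  | nil => simp at hv
  | cons x s ih =>
    cases s with
    | nil => simp [dl]
    | cons y s =>
      have := ih (by simp) h.of_cons
      have e : (x :: y :: s).reverse = s.reverse ++ [y, x] := by simp
      rw [e, dl_snoc]
      have hne : x ≠ y := by
        rintro rfl; simp at h
      simp only [List.reverse_cons, dl, List.length_cons] at this ⊢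
      rcases lt_or_gt_of_ne hne with h1 | h1
      · simp only [h1, not_lt.2 h1.le, if_true, if_false]; omega
      · simp only [h1, not_lt.2 h1.le, if_true, if_false]; omega

theorem RR.dl_eq {M : α} {u u' : List α} (h : RR M u u') : dl u + dl u' + 1 = u.length := by
  induction h with
  | base => simp [dl]
  | c1 a u u' h hl ih =>
    have h' : ∀ x ∈ u', a < x := fun x hx => hl x (h.perm.mem_iff.2 hx)
    rw [dl_append _ _ (List.ne_nil_of_mem h.mem') h', dl_cons _ hl]
    simp [dl]; omega
  | c2 a u u' h hl ih =>
    have h' : ∀ x ∈ u', a < x := fun x hx => hl x (h.perm.mem_iff.2 hx)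
    rw [dl_append _ _ (List.ne_nil_of_mem h.mem) hl, dl_cons _ h']
    simp [dl]; omega
  | c3 a u u' v h hl hv hv0 hn hM ih =>
    have h' : ∀ x ∈ u', a < x := fun x hx => hl x (h.perm.mem_iff.2 hx)
    have := dl_reverse v hv0 hn
    rw [dl_append _ _ (List.ne_nil_of_mem h.mem) hl, dl_append _ _ (List.ne_nil_of_mem h.mem') h',
      dl_cons _ hv, dl_cons v.reverse (by simpa using hv)]
    simp; omega

theorem split_unique {a b : α} {u v u2 v2 : List α} (h : u ++ a :: v = u2 ++ b :: v2)
    (hu : ∀ x ∈ u, a < x) (hv : ∀ x ∈ v, a < x) (hu2 : ∀ x ∈ u2, b < x) (hv2 : ∀ x ∈ v2, b < x) :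
    a = b ∧ u = u2 ∧ v = v2 := by
  have hab : a = b := by
    have h1 : a ∈ u2 ++ b :: v2 := by rw [← h]; simp
    have h2 : b ∈ u ++ a :: v := by rw [h]; simp
    apply le_antisymm
    · rcases List.mem_append.1 h2 with h | h
      · exact (hu _ h).le
      · rcases List.mem_cons.1 h with h | h
        · exact h.ge
        · exact (hv _ h).le
    · rcases List.mem_append.1 h1 with h | h
      · exact (hu2 _ h).le
      · rcases List.mem_cons.1 h with h | h
        · exact h.ge
        · exact (hv2 _ h).le
  subst hab
  refine ⟨rfl, ?_⟩
  induction u generalizing u2 with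
  | nil =>
    cases u2 with
    | nil => simpa using h
    | cons y s =>
      simp only [List.nil_append, List.cons_append, List.cons.injEq] at h
      exact absurd (hu2 y (by simp)) (by rw [h.1]; exact lt_irrefl _)
  | cons x s ih =>
    cases u2 with
    | nil =>
      simp only [List.nil_append, List.cons_append, List.cons.injEq] at h
      exact absurd (hu x (by simp)) (by rw [h.1]; exact lt_irrefl _)
    | cons y s2 =>
      simp only [List.cons_append, List.cons.injEq] at h
      obtain ⟨h1, h2⟩ := ih (fun z hz => hu z (by simp [hz])) h.2 (fun z hz => hu2 z (by simp [hz]))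
      exact ⟨by rw [h.1, h1], h2⟩

/-- inversion of the relation, in a uniform shape -/
theorem RR.inv {M : α} {w t : List α} (h : RR M w t) : (w = [M] ∧ t = [M]) ∨
    ∃ a u' v', t = u' ++ a :: v' ∧ (∀ x ∈ u', a < x) ∧ (∀ x ∈ v', a < x) ∧ 2 ≤ t.length ∧
    ((v' = [] ∧ ∃ u, RR M u u' ∧ w = a :: u) ∨ (u' = [] ∧ ∃ u, RR M u v' ∧ w = u ++ [a]) ∨
     (u' ≠ [] ∧ v' ≠ [] ∧ ∃ u, RR M u u' ∧ w = u ++ a :: v'.reverse)) := by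
  cases h with
  | base => simp
  | c1 a u u' h hl =>
    have h' : ∀ x ∈ u', a < x := fun x hx => hl x (h.perm.mem_iff.2 hx)
    have := List.length_pos_of_mem h.mem'
    exact Or.inr ⟨a, u', [], rfl, h', by simp, by simp; omega, Or.inl ⟨rfl, u, h, rfl⟩⟩
  | c2 a u u' h hl =>
    have h' : ∀ x ∈ u', a < x := fun x hx => hl x (h.perm.mem_iff.2 hx)
    have := List.length_pos_of_mem h.mem'
    exact Or.inr ⟨a, [], u', rfl, by simp, h', by simp; omega, Or.inr (Or.inl ⟨rfl, u, h, rfl⟩)⟩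
  | c3 a u u' v h hl hv hv0 hn hM =>
    have h' : ∀ x ∈ u', a < x := fun x hx => hl x (h.perm.mem_iff.2 hx)
    have := List.length_pos_of_mem h.mem'
    exact Or.inr ⟨a, u', v.reverse, rfl, h', by simpa using hv, by simp; omega,
      Or.inr (Or.inr ⟨List.ne_nil_of_mem h.mem', by simpa using hv0, u, h, by simp⟩)⟩

theorem RR.unique {M : α} (n : ℕ) : ∀ {w w2 t : List α}, t.length ≤ n → RR M w t → RR M w2 t →
    w = w2 := by
  induction n with
  | zero =>
    intro w w2 t hn h _
    have := List.length_pos_of_mem h.mem'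
    omega
  | succ n ih =>
    intro w w2 t hn h h2
    rcases h.inv with ⟨rfl, ht⟩ | ⟨a, u, v, ht, hu, hv, hlen, hc⟩
    · rcases h2.inv with ⟨rfl, _⟩ | ⟨_, _, _, _, _, _, hlen, _⟩
      · rfl
      · simp [ht] at hlen
    · rcases h2.inv with ⟨_, ht'⟩ | ⟨b, u2, v2, ht2, hu2, hv2, _, hc2⟩
      · simp [ht'] at hlen
      · obtain ⟨rfl, rfl, rfl⟩ := split_unique (ht.symm.trans ht2) hu hv hu2 hv2
        have hl : t.length = u.length + v.length + 1 := by rw [ht]; simp; omega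
        have hul : u.length ≤ n := by omega
        have hvl : v.length ≤ n := by omega
        rcases hc with ⟨e, p, hp, rfl⟩ | ⟨e, p, hp, rfl⟩ | ⟨e, e', p, hp, rfl⟩ <;>
        rcases hc2 with ⟨f, q, hq, rfl⟩ | ⟨f, q, hq, rfl⟩ | ⟨f, f', q, hq, rfl⟩
        · rw [ih hul hp hq]
        · subst e; subst f; simp [ht] at hlen
        · exact absurd e f'
        · subst e; subst f; simp [ht] at hlen
        · rw [ih hvl hp hq]
        · exact absurd e f
        · exact absurd f e'
        · exact absurd f e
        · rw [ih hul hp hq]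

theorem RR.total {M : α} (n : ℕ) : ∀ {w : List α}, w.length ≤ n → w.Nodup → M ∈ w →
    (∀ x ∈ w, x ≤ M) → QL M w → ∃ t, RR M w t := by
  induction n with
  | zero =>
    intro w hn _ h
    have := List.length_pos_of_mem h
    omega
  | succ n ih =>
    intro w hn hnd hM hmax hQ
    obtain ⟨a, ha, hmin⟩ := w.toFinset.exists_min_image id ⟨M, by simpa using hM⟩
    simp only [List.mem_toFinset, id] at ha hmin
    obtain ⟨u, v, rfl⟩ := List.append_of_mem ha
    have hnd' := hnd
    rw [List.nodup_middle, List.nodup_cons, List.mem_append, not_or] at hnd'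
    obtain ⟨⟨hau, hav⟩, huv⟩ := hnd'
    have hu : ∀ x ∈ u, a < x := fun x hx => lt_of_le_of_ne (hmin x (by simp [hx]))
      (by rintro rfl; exact hau hx)
    have hv : ∀ x ∈ v, a < x := fun x hx => lt_of_le_of_ne (hmin x (by simp [hx]))
      (by rintro rfl; exact hav hx)
    simp only [List.length_append, List.length_cons] at hn
    by_cases hMu : M ∈ u
    · have hMv : M ∉ v := fun h => (List.disjoint_of_nodup_append huv) hMu h
      have hMa : M ≠ a := (hu M hMu).ne'
      rw [QL_append _ _ (by simp [hMa, hMv])] at hQ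
      obtain ⟨t, ht⟩ := ih (by omega) huv.of_append_left hMu (fun x hx => hmax x (by simp [hx])) hQ
      by_cases hv0 : v = []
      · subst hv0; exact ⟨_, RR.c2 a u t ht hu⟩
      · exact ⟨_, RR.c3 a u t v ht hu hv hv0 huv.of_append_right hMv⟩
    · have hMv : M ∈ a :: v := by
        rcases List.mem_append.1 hM with h | h
        · exact absurd h hMu
        · exact h
      have hu0 : u = [] := by
        by_contra h0
        obtain ⟨x, hx, hxa⟩ := QL_mem u v h0 hMv hQ
        exact absurd (hu x hx) hxa.not_gt
      subst hu0
      by_cases hMv' : M ∈ v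
      · simp only [List.nil_append] at hQ huv ⊢
        rw [QL_cons _ hv] at hQ
        obtain ⟨t, ht⟩ := ih (by omega) huv hMv' (fun x hx => hmax x (by simp [hx])) hQ
        exact ⟨_, RR.c1 a v t ht hv⟩
      · have hMa : M = a := by simpa [hMv'] using hMv
        subst hMa
        have : v = [] := by
          apply List.eq_nil_iff_forall_not_mem.2
          intro x hx
          exact absurd (hv x hx) (hmax x (by simp [hx])).not_gt
        subst this
        exact ⟨_, RR.base⟩

theorem dl_ofFn (m : ℕ) : ∀ f : Fin (m + 1) → α,
    dl (List.ofFn f) = (Finset.univ.filter fun i : Fin m => f i.succ < f i.castSucc).card := by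
  induction m with
  | zero => intro f; simp [dl]
  | succ m ih =>
    intro f
    have h := ih (fun i => f i.succ)
    rw [Finset.card_filter] at h ⊢
    rw [Fin.sum_univ_succ, List.ofFn_succ]
    rw [List.ofFn_succ] at h ⊢
    simp only [dl, h]
    rfl

theorem QL_ofFn (M : α) (m : ℕ) : ∀ f : Fin (m + 1) → α,
    QL M (List.ofFn f) ↔ ∀ i : Fin m, (∃ j, i.succ ≤ j ∧ f j = M) → f i.castSucc < f i.succ := by
  induction m with
  | zero => intro f; simp [QL]
  | succ m ih =>
    intro f
    have h := ih (fun i => f i.succ)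
    have hmem : M ∈ List.ofFn (fun i : Fin (m + 1) => f i.succ) ↔
        ∃ j, (0 : Fin (m + 1)).succ ≤ j ∧ f j = M := by
      rw [List.mem_ofFn]
      constructor
      · rintro ⟨i, rfl⟩
        exact ⟨i.succ, Fin.succ_le_succ_iff.2 (Fin.zero_le i), rfl⟩
      · rintro ⟨j, hj, rfl⟩
        cases j using Fin.cases with
        | zero => simp at hj
        | succ j => exact ⟨j, rfl⟩
    rw [Fin.forall_fin_succ, List.ofFn_succ, ← hmem]
    have key : (∀ i : Fin m, (∃ j, i.succ.succ ≤ j ∧ f j = M) → f i.succ.castSucc < f i.succ.succ) ↔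
        QL M (List.ofFn (fun i : Fin (m + 1) => f i.succ)) := by
      rw [h]
      refine forall_congr' fun i => ?_
      have : (∃ j, i.succ.succ ≤ j ∧ f j = M) ↔ (∃ j : Fin (m+1), i.succ ≤ j ∧ f j.succ = M) := by
        constructor
        · rintro ⟨j, hj, rfl⟩
          cases j using Fin.cases with
          | zero => simp at hj
          | succ j => exact ⟨j, by simpa using hj, rfl⟩
        · rintro ⟨j, hj, rfl⟩
          exact ⟨j.succ, by simpa using hj, rfl⟩
      rw [this]
      rfl
    rw [key]
    rw [List.ofFn_succ]
    rfl

end helpers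

theorem mem_Qset_iff {m : ℕ} (π : Equiv.Perm (Fin (m + 1))) :
    π ∈ Qset m ↔ QL (Fin.last m) (List.ofFn π) := by
  rw [QL_ofFn]
  simp only [Qset, Finset.mem_filter, Finset.mem_univ, true_and]
  refine forall_congr' fun i => ?_
  have : (∃ j, i.succ ≤ j ∧ π j = Fin.last m) ↔ i.succ ≤ π⁻¹ (Fin.last m) := by
    constructor
    · rintro ⟨j, hj, h⟩
      rw [← h]; simpa using hj
    · intro h
      exact ⟨_, h, by simp⟩
  rw [this]

theorem des_eq_dl {m : ℕ} (π : Equiv.Perm (Fin (m + 1))) : des π = dl (List.ofFn π) := by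
  rw [dl_ofFn]; rfl

theorem exists_perm {N : ℕ} (L : List (Fin N)) (hl : L.length = N) (hn : L.Nodup) :
    ∃ σ : Equiv.Perm (Fin N), List.ofFn σ = L := by
  have hinj : Function.Injective (fun i : Fin N => L.get (i.cast hl.symm)) := by
    intro i j h
    have := List.nodup_iff_injective_get.1 hn h
    simpa using this
  refine ⟨Equiv.ofBijective _ (Finite.injective_iff_bijective.1 hinj), ?_⟩
  apply List.ext_get
  · simp [hl]
  · intro i h1 h2
    simp

theorem Atil_le (n k : ℕ) (hk : k ≤ n) : Atil n k ≤ Atil n (n - k) := by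
  unfold Atil
  apply Finset.card_le_card_of_forall_subsingleton
    (fun π σ : Equiv.Perm (Fin (n + 1)) => RR (Fin.last n) (List.ofFn π) (List.ofFn σ))
  · intro π hπ
    rw [Finset.mem_filter, mem_Qset_iff, des_eq_dl] at hπ
    obtain ⟨t, ht⟩ := RR.total (n + 1) (by simp) (List.nodup_ofFn.2 π.injective)
      (by rw [List.mem_ofFn]; exact π.surjective _) (fun x _ => Fin.le_last x) hπ.1
    have hlen : t.length = n + 1 := by rw [← ht.perm.length_eq]; simp
    obtain ⟨σ, rfl⟩ := exists_perm t hlen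
      (ht.perm.nodup_iff.1 (List.nodup_ofFn.2 π.injective))
    refine ⟨σ, ?_, ht⟩
    rw [Finset.mem_filter, mem_Qset_iff, des_eq_dl]
    refine ⟨ht.QL', ?_⟩
    have := ht.dl_eq
    rw [List.length_ofFn] at this
    omega
  · intro σ _ π hπ π' hπ'
    have := RR.unique _ le_rfl hπ.2 hπ'.2
    exact DFunLike.coe_injective (List.ofFn_injective this)

/-- The binomial-Eulerian polynomials are symmetric. -/
theorem Atil_symmetric (n k : ℕ) (hk : k ≤ n) : Atil n k = Atil n (n - k) := by
  apply le_antisymm (Atil_le n k hk)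
  have := Atil_le n (n - k) (Nat.sub_le n k)
  rwa [Nat.sub_sub_self hk] at this
end

section
/- For every integer n ≥ 1, the polynomial identity Ã_n(x) = Σ_{j=1}^{n} C(n,j)·(x−1)^{j−1}·Ã_{n−j}(x) + x^n holds, where C(n,j) is the binomial coefficient. -/
open Finset Polynomial

/-- Binomial-Eulerian polynomial refined by the last entry. -/
noncomputable def aref (m : ℕ) (p : Fin (m + 1)) : Polynomial ℤ :=
  ∑ π ∈ (Qset m).filter (fun π => π (Fin.last m) = p), X ^ des π

theorem sum_aref (m : ℕ) : ∑ p, aref m p = Atilpoly m := by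
  unfold aref Atilpoly
  exact Finset.sum_fiberwise (Qset m) (fun π => π (Fin.last m)) (fun π => (X : ℤ[X]) ^ des π)

theorem mem_Qset_iff_s10 {m : ℕ} (π : Equiv.Perm (Fin (m + 1))) :
    π ∈ Qset m ↔ ∀ k, π k = Fin.last m → ∀ i : Fin m, i.succ ≤ k →
      π i.castSucc < π i.succ := by
  simp only [Qset, Finset.mem_filter, Finset.mem_univ, true_and]
  constructor
  · intro h k hk i hi
    apply h
    rw [← hk]
    simpa using hi
  · intro h i hi
    exact h _ (by simp) i hi

theorem aref_last (m : ℕ) : aref m (Fin.last m) = 1 := by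
  have h : (Qset m).filter (fun π => π (Fin.last m) = Fin.last m) = {1} := by
    ext π
    simp only [Finset.mem_filter, mem_Qset_iff_s10, Finset.mem_singleton]
    constructor
    · rintro ⟨h1, h2⟩
      have hm : StrictMono π := by
        rw [Fin.strictMono_iff_lt_succ]
        intro i
        exact h1 _ h2 i (Fin.le_last _)
      have h3 : Set.range (π : Fin (m+1) → Fin (m+1)) = Set.range (id : Fin (m+1) → Fin (m+1)) := by
        rw [π.surjective.range_eq, Set.range_id]
      have := (StrictMono.range_inj hm strictMono_id).1 h3
      ext i
      rw [this]
      rfl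
    · rintro rfl
      refine ⟨?_, rfl⟩
      intro k _ i _
      simp
  rw [aref, h]
  have hd : des (1 : Equiv.Perm (Fin (m + 1))) = 0 := by
    unfold des
    rw [Finset.card_eq_zero, Finset.filter_eq_empty_iff]
    intro i _
    exact not_lt.2 (Fin.castSucc_lt_succ (i := i)).le
  simp [hd]

/-- Append a last entry. -/
def app {m : ℕ} (p : Fin (m + 1)) (σ : Equiv.Perm (Fin m)) : Equiv.Perm (Fin (m + 1)) :=
  (finSuccEquiv' (Fin.last m)).trans ((Equiv.optionCongr σ).trans (finSuccEquiv' p).symm)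

theorem app_last {m : ℕ} (p : Fin (m + 1)) (σ : Equiv.Perm (Fin m)) :
    app p σ (Fin.last m) = p := by
  simp [app]

theorem app_castSucc {m : ℕ} (p : Fin (m + 1)) (σ : Equiv.Perm (Fin m)) (i : Fin m) :
    app p σ i.castSucc = p.succAbove (σ i) := by
  have h : finSuccEquiv' (Fin.last m) i.castSucc = some i := by
    rw [← Fin.succAbove_last_apply, finSuccEquiv'_succAbove]
  simp [app, h]

theorem app_surj {m : ℕ} (π : Equiv.Perm (Fin (m + 1))) :
    ∃ σ, app (π (Fin.last m)) σ = π := by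
  have h : ∀ i : Fin m, ∃ j, (π (Fin.last m)).succAbove j = π i.castSucc := by
    intro i
    apply Fin.exists_succAbove_eq
    intro h
    exact (Fin.castSucc_lt_last i).ne (π.injective h)
  choose f hf using h
  have hinj : Function.Injective f := by
    intro a b hab
    have := hf a
    rw [hab, hf b] at this
    exact (Fin.castSucc_injective _ (π.injective this)).symm
  refine ⟨Equiv.ofBijective f (Finite.injective_iff_bijective.1 hinj), ?_⟩
  apply Equiv.ext
  intro i
  induction i using Fin.lastCases with
  | last => rw [app_last]
  | cast i => rw [app_castSucc]; exact hf i

theorem app_inj {m : ℕ} (p : Fin (m + 1)) : Function.Injective (app p) := by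
  intro a b h
  ext i : 1
  have := congrArg (fun e : Equiv.Perm (Fin (m+1)) => e i.castSucc) h
  simpa [app_castSucc] using this

theorem des_app {m : ℕ} (p : Fin (m + 2)) (σ : Equiv.Perm (Fin (m + 1))) :
    des (app p σ) = des σ + if p ≤ (σ (Fin.last m)).castSucc then 1 else 0 := by
  unfold des
  rw [Finset.card_filter, Finset.card_filter, Fin.sum_univ_castSucc]
  congr 1
  · apply Finset.sum_congr rfl
    intro i _
    rw [Fin.succ_castSucc, app_castSucc, app_castSucc]
    simp
  · rw [Fin.succ_last, app_last, app_castSucc]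
    congr 1
    rw [Fin.lt_succAbove_iff_le_castSucc]

theorem app_mem {m : ℕ} (p : Fin (m + 1)) (σ : Equiv.Perm (Fin (m + 1))) :
    app p.castSucc σ ∈ Qset (m + 1) ↔ σ ∈ Qset m := by
  have hl : ∀ k, p.castSucc.succAbove (σ k) = Fin.last (m + 1) ↔ σ k = Fin.last m := by
    intro k
    rw [← Fin.succAbove_ne_last_last (a := p.castSucc) (Fin.castSucc_lt_last p).ne]
    exact (Fin.succAbove_right_injective).eq_iff
  rw [mem_Qset_iff_s10, mem_Qset_iff_s10]
  constructor
  · intro h k hk i hi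
    have := h k.castSucc (by rw [app_castSucc, hl, hk]) i.castSucc
      (by rw [Fin.succ_castSucc]; exact Fin.castSucc_le_castSucc_iff.2 hi)
    rw [Fin.succ_castSucc, app_castSucc, app_castSucc] at this
    simpa using this
  · intro h k
    induction k using Fin.lastCases with
    | last => 
      intro hk
      rw [app_last] at hk
      exact absurd hk (Fin.castSucc_lt_last p).ne
    | cast k =>
      intro hk i
      rw [app_castSucc, hl] at hk
      induction i using Fin.lastCases with
      | last => 
        intro hi
        rw [Fin.succ_last] at hi
        exact absurd hi (not_le.2 (Fin.castSucc_lt_last k))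
      | cast i =>
        intro hi
        rw [Fin.succ_castSucc] at hi ⊢
        rw [app_castSucc, app_castSucc]
        simpa using h k hk i (Fin.castSucc_le_castSucc_iff.1 hi)

theorem aref_castSucc (m : ℕ) (p : Fin (m + 1)) :
    aref (m + 1) p.castSucc = ∑ q, (if p ≤ q then X else 1) * aref m q := by
  have h1 : aref (m + 1) p.castSucc =
      ∑ σ ∈ Qset m, (if p ≤ σ (Fin.last m) then X else 1) * X ^ des σ := by
    unfold aref
    symm
    apply Finset.sum_nbij (app p.castSucc)
    · intro σ hσ
      rw [Finset.mem_filter, app_mem, app_last]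
      exact ⟨hσ, rfl⟩
    · exact (app_inj _).injOn
    · intro π hπ
      rw [Finset.mem_coe, Finset.mem_filter] at hπ
      obtain ⟨σ, hσ⟩ := app_surj π
      rw [hπ.2] at hσ
      refine ⟨σ, ?_, hσ⟩
      rw [Finset.mem_coe, ← app_mem p, hσ]
      exact hπ.1
    · intro σ _
      rw [des_app]
      simp only [Fin.castSucc_le_castSucc_iff]
      split_ifs <;> ring
  rw [h1, ← Finset.sum_fiberwise (Qset m) (fun π => π (Fin.last m))]
  apply Finset.sum_congr rfl
  intro q _
  unfold aref
  rw [Finset.mul_sum]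
  apply Finset.sum_congr rfl
  intro σ hσ
  rw [(Finset.mem_filter.1 hσ).2]

/-- Auxiliary weighted sums. -/
noncomputable def uu (m j : ℕ) : Polynomial ℤ :=
  ∑ q : Fin (m + 1), (((q : ℕ) + j).choose j : ℤ[X]) * aref m q

theorem hockey (k j : ℕ) :
    ∑ p ∈ Finset.range k, (p + j).choose j = (k + j).choose (j + 1) := by
  induction k with
  | zero => simp
  | succ k ih =>
    rw [Finset.sum_range_succ, ih, show k + 1 + j = (k + j) + 1 by ring, Nat.choose_succ_succ]
    ring

theorem hockey' (m j : ℕ) (q : Fin (m + 1)) :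
    ∑ p : Fin (m + 1), (if p ≤ q then (((p : ℕ) + j).choose j : ℤ[X]) else 0)
      = (((q : ℕ) + (j + 1)).choose (j + 1) : ℤ[X]) := by
  have h := Fin.sum_univ_eq_sum_range
    (fun p => if p ≤ (q : ℕ) then ((p + j).choose j : ℤ[X]) else 0) (m + 1)
  simp only [Fin.le_def]
  rw [h, ← Finset.sum_filter]
  have : (Finset.range (m + 1)).filter (fun p => p ≤ (q : ℕ)) = Finset.range (q + 1) := by
    ext x
    simp only [Finset.mem_filter, Finset.mem_range]
    omega
  rw [this]
  have h2 := hockey (q + 1) j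
  rw [show (q : ℕ) + (j + 1) = q + 1 + j by ring]
  exact_mod_cast congrArg (Nat.cast : ℕ → ℤ[X]) h2

theorem uu_succ (m j : ℕ) :
    uu (m + 1) j = ((m + 1 + j).choose j : ℤ[X])
      + ((m + 1 + j).choose (j + 1) : ℤ[X]) * Atilpoly m + (X - 1) * uu m (j + 1) := by
  have hs : ∑ p : Fin (m + 1), (((p : ℕ) + j).choose j : ℤ[X])
      = ((m + 1 + j).choose (j + 1) : ℤ[X]) := by
    rw [Fin.sum_univ_eq_sum_range (fun p => ((p + j).choose j : ℤ[X]))]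
    exact_mod_cast congrArg (Nat.cast : ℕ → ℤ[X]) (hockey (m + 1) j)
  unfold uu
  rw [Fin.sum_univ_castSucc, aref_last, ← hs, ← sum_aref, Finset.sum_mul_sum, Finset.mul_sum]
  have h2 : ∀ q : Fin (m + 1),
      (X - 1) * ((((q : ℕ) + (j + 1)).choose (j + 1) : ℤ[X]) * aref m q)
      = ∑ p : Fin (m + 1), (X - 1) *
        ((if p ≤ q then (((p : ℕ) + j).choose j : ℤ[X]) else 0) * aref m q) := by
    intro q
    rw [← hockey', Finset.sum_mul, Finset.mul_sum]
  rw [Finset.sum_congr rfl (fun q _ => h2 q), Finset.sum_comm (s := Finset.univ) (t := Finset.univ)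
    (f := fun q p : Fin (m + 1) => (X - 1) *
        ((if p ≤ q then (((p : ℕ) + j).choose j : ℤ[X]) else 0) * aref m q))]
  refine (add_comm _ _).trans (Eq.trans ?_ (add_assoc _ _ _).symm)
  rw [← Finset.sum_add_distrib]
  congr 1
  · simp
  · apply Finset.sum_congr rfl
    intro p _
    rw [aref_castSucc, Finset.mul_sum, ← Finset.sum_add_distrib]
    apply Finset.sum_congr rfl
    intro q _
    simp only [Fin.val_castSucc]
    split_ifs <;> ring

theorem uu_zero_right (m : ℕ) : uu m 0 = Atilpoly m := by
  simp [uu, ← sum_aref]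

theorem uu_zero_left (j : ℕ) : uu 0 j = 1 := by
  have := aref_last 0
  simp only [uu]
  simpa using this

theorem uu_expand (n k : ℕ) (hk : k ≤ n) :
    Atilpoly n = (∑ j ∈ Finset.range k, ((X - 1) ^ j * (n.choose j : ℤ[X])
      + (n.choose (j + 1) : ℤ[X]) * (X - 1) ^ j * Atilpoly (n - (j + 1))))
      + (X - 1) ^ k * uu (n - k) k := by
  induction k with
  | zero => simp [uu_zero_right]
  | succ k ih =>
    rw [ih (by omega), Finset.sum_range_succ]
    obtain ⟨m, rfl⟩ : ∃ m, n = m + 1 + k := ⟨n - (k + 1), by omega⟩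
    rw [show m + 1 + k - k = m + 1 by omega, show m + 1 + k - (k + 1) = m by omega, uu_succ]
    ring

theorem Atilpoly_nth_order_recurrence (n : ℕ) (hn : 1 ≤ n) :
    Atilpoly n =
      (∑ j ∈ Finset.Icc 1 n, (n.choose j : Polynomial ℤ) * (X - 1) ^ (j - 1) * Atilpoly (n - j))
        + X ^ n := by
  have hX : (X : ℤ[X]) ^ n = (∑ j ∈ Finset.range n, (X - 1) ^ j * (n.choose j : ℤ[X]))
      + (X - 1) ^ n := by
    have h := add_pow (X - 1 : ℤ[X]) 1 n
    rw [Finset.sum_range_succ] at h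
    simpa using h
  have hI : ∑ j ∈ Finset.Icc 1 n,
      (n.choose j : Polynomial ℤ) * (X - 1) ^ (j - 1) * Atilpoly (n - j)
      = ∑ j ∈ Finset.range n,
        (n.choose (j + 1) : ℤ[X]) * (X - 1) ^ j * Atilpoly (n - (j + 1)) := by
    rw [← Finset.Ico_add_one_right_eq_Icc, Finset.sum_Ico_eq_sum_range]
    apply Finset.sum_congr (by simp)
    intro j _
    rw [add_comm 1 j, Nat.add_sub_cancel]
  rw [uu_expand n n le_rfl, hI, hX, Finset.sum_add_distrib, Nat.sub_self, uu_zero_left]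
  ring
end
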